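/- Let L > 0. There exists a constant C > 0, depending only on L, with the following property. For every positive integer N, with N* = 2N+1 and h = L/N*, and every smooth (C^∞) function f : ℝ³ → ℝ that is L-periodic in each variable, the truncation error τ_{i,j,k} = (Δ_{h,(4)} f)(x_i, y_j, z_k) − (Δ f)(x_i, y_j, z_k) at the grid points (x_i, y_j, z_k) = (i·h, j·h, k·h) satisfies ( h³ ∑_{i,j,k=0}^{N*−1} τ_{i,j,k}² )^{1/2} ≤ C · h⁴ · ‖f‖_{H⁶(Ω)}, where Ω = (0,L)³ and ‖f‖_{H⁶(Ω)}² = ∑_{|α|≤6} ‖∂^α f‖²_{L²(Ω)}. -/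

import Mathlib

open Real MeasureTheory Finset

/-- Mixed partial derivative `∂_x^a ∂_y^b ∂_z^c f` of a function of three real variables. -/
noncomputable def partialDeriv3D (a b c : ℕ) (f : ℝ → ℝ → ℝ → ℝ) (x y z : ℝ) : ℝ :=
  iteratedDeriv a (fun s => iteratedDeriv b (fun u => iteratedDeriv c (f s u) z) y) x

/-- Squared `H⁶` norm of `f` on `Ω = (0,L)³`: the sum of the squared `L²` norms of
all partial derivatives `∂^α f` with `|α| ≤ 6`. -/
noncomputable def H6normSq3D (L : ℝ) (f : ℝ → ℝ → ℝ → ℝ) : ℝ :=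
  ∑ a ∈ Finset.range 7, ∑ b ∈ Finset.range (7 - a), ∑ c ∈ Finset.range (7 - a - b),
    ∫ x in (0 : ℝ)..L, ∫ y in (0 : ℝ)..L, ∫ z in (0 : ℝ)..L,
      (partialDeriv3D a b c f x y z) ^ 2

/-- The 3-D long stencil fourth order discrete Laplacian
`Δ_{h,(4)} = D²_{x,(4)} + D²_{y,(4)} + D²_{z,(4)}`. -/
noncomputable def discLap4_3D (h : ℝ) (f : ℝ → ℝ → ℝ → ℝ) (x y z : ℝ) : ℝ :=
  (-f (x - 2 * h) y z + 16 * f (x - h) y z - 30 * f x y z + 16 * f (x + h) y z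
      - f (x + 2 * h) y z) / (12 * h ^ 2)
    + (-f x (y - 2 * h) z + 16 * f x (y - h) z - 30 * f x y z + 16 * f x (y + h) z
      - f x (y + 2 * h) z) / (12 * h ^ 2)
    + (-f x y (z - 2 * h) + 16 * f x y (z - h) - 30 * f x y z + 16 * f x y (z + h)
      - f x y (z + 2 * h)) / (12 * h ^ 2)

/-- The continuous Laplacian `Δ f = ∂²_x f + ∂²_y f + ∂²_z f`. -/
noncomputable def contLap3D (f : ℝ → ℝ → ℝ → ℝ) (x y z : ℝ) : ℝ :=
  deriv (deriv (fun s => f s y z)) x + deriv (deriv (fun u => f x u z)) y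
    + deriv (deriv (f x y)) z

/-- Cauchy–Schwarz on an interval, against the constant function. -/
theorem sq_integral_abs_le {u : ℝ → ℝ} (hu : Continuous u) {a b : ℝ} (hab : a < b) :
    (∫ t in a..b, |u t|) ^ 2 ≤ (b - a) * ∫ t in a..b, u t ^ 2 := by
  set A := ∫ t in a..b, |u t| with hA
  have hb : 0 < b - a := sub_pos.2 hab
  have h0 : 0 ≤ ∫ t in a..b, (|u t| - A / (b - a)) ^ 2 :=
    intervalIntegral.integral_nonneg hab.le fun t _ => sq_nonneg _
  have h1 : ∫ t in a..b, (|u t| - A / (b - a)) ^ 2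
      = (∫ t in a..b, u t ^ 2) - 2 * (A / (b - a)) * A + (b - a) * (A / (b - a)) ^ 2 := by
    have : ∀ t, (|u t| - A / (b - a)) ^ 2
        = u t ^ 2 - 2 * (A / (b - a)) * |u t| + (A / (b - a)) ^ 2 := fun t => by
      rw [sub_sq, sq_abs]; ring
    simp_rw [this]
    rw [intervalIntegral.integral_add, intervalIntegral.integral_sub,
      intervalIntegral.integral_const_mul, intervalIntegral.integral_const, smul_eq_mul]
    all_goals exact Continuous.intervalIntegrable (by fun_prop) _ _
  have h2 : (b - a) * (∫ t in a..b, (|u t| - A / (b - a)) ^ 2)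
      = (b - a) * (∫ t in a..b, u t ^ 2) - A ^ 2 := by
    rw [h1]; field_simp; ring
  nlinarith [mul_nonneg hb.le h0]

theorem sum_integral_cells {u : ℝ → ℝ} (hu : Continuous u) (h : ℝ) (n : ℕ) :
    ∑ j ∈ range n, ∫ t in (j * h : ℝ)..(j * h + h), u t = ∫ t in (0 : ℝ)..(n * h), u t := by
  have := intervalIntegral.sum_integral_adjacent_intervals (μ := volume) (f := u) (n := n)
    (a := fun j : ℕ => (j * h : ℝ)) fun k _ => hu.intervalIntegrable _ _
  simpa [add_mul] using this

/-- Discrete trace inequality: grid sums are controlled by the `H¹` norm. -/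
theorem sum_sq_grid_le {g : ℝ → ℝ} (hg : ContDiff ℝ 1 g) {h : ℝ} (hh : 0 < h) (n : ℕ) :
    h * ∑ j ∈ range n, g (j * h) ^ 2
      ≤ 2 * (∫ t in (0 : ℝ)..(n * h), g t ^ 2)
        + 2 * h ^ 2 * ∫ t in (0 : ℝ)..(n * h), deriv g t ^ 2 := by
  have hd : Continuous (deriv g) := hg.continuous_deriv le_rfl
  have hc : Continuous g := hg.continuous
  have cell : ∀ a : ℝ, h * g a ^ 2 ≤ 2 * (∫ t in a..(a + h), g t ^ 2)
      + 2 * h ^ 2 * ∫ t in a..(a + h), deriv g t ^ 2 := by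
    intro a
    set B := ∫ t in a..(a + h), deriv g t ^ 2 with hB
    have key : ∀ t ∈ Set.Icc a (a + h), g a ^ 2 ≤ 2 * g t ^ 2 + 2 * h * B := by
      intro t ht
      have e : ∫ s in a..t, deriv g s = g t - g a :=
        intervalIntegral.integral_deriv_eq_sub
          (fun s _ => (hg.differentiable one_ne_zero).differentiableAt) (hd.intervalIntegrable _ _)
      have h1 : |g t - g a| ≤ ∫ s in a..(a + h), |deriv g s| := by
        rw [← e]
        refine (intervalIntegral.abs_integral_le_integral_abs ht.1).trans ?_
        exact intervalIntegral.integral_mono_interval le_rfl ht.1 ht.2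
          (Filter.Eventually.of_forall fun s => abs_nonneg _)
          (hd.abs.intervalIntegrable _ _)
      have h2 := sq_integral_abs_le hd (show a < a + h by linarith)
      have h3 : (g t - g a) ^ 2 ≤ h * B := by
        calc (g t - g a) ^ 2 = |g t - g a| ^ 2 := (sq_abs _).symm
          _ ≤ _ := pow_le_pow_left₀ (abs_nonneg _) h1 2
          _ ≤ _ := h2
          _ = h * B := by rw [add_sub_cancel_left]
      nlinarith [sq_nonneg (2 * g t - g a)]
    have := intervalIntegral.integral_mono_on (a := a) (b := a + h) (μ := volume) (by linarith)
      (f := fun _ => g a ^ 2) (g := fun t => 2 * g t ^ 2 + 2 * h * B)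
      (Continuous.intervalIntegrable (by fun_prop) _ _)
      (Continuous.intervalIntegrable (by fun_prop) _ _) key
    rw [intervalIntegral.integral_add (Continuous.intervalIntegrable (by fun_prop) _ _)
      (Continuous.intervalIntegrable (by fun_prop) _ _), intervalIntegral.integral_const_mul,
      intervalIntegral.integral_const, intervalIntegral.integral_const] at this
    simp only [smul_eq_mul, add_sub_cancel_left] at this
    linarith
  rw [← sum_integral_cells (by fun_prop : Continuous fun t => g t ^ 2),
    ← sum_integral_cells (by fun_prop : Continuous fun t => deriv g t ^ 2),
    mul_sum, mul_sum, mul_sum, ← sum_add_distrib]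
  exact sum_le_sum fun j _ => cell _

/-- Taylor expansion with a remainder controlled by the `L¹` norm of the last derivative. -/
theorem taylor_remainder_le (n : ℕ) {g : ℝ → ℝ} (hg : ContDiff ℝ (⊤ : ℕ∞) g) (x : ℝ) {r : ℝ}
    {s : ℝ} (hs : |s| ≤ r) :
    |g (x + s) - ∑ k ∈ range (n + 1), deriv^[k] g x * s ^ k / k.factorial|
      ≤ r ^ n * ∫ t in (x - r)..(x + r), |deriv^[n + 1] g t| := by
  have hr : 0 ≤ r := (abs_nonneg s).trans hs
  induction n generalizing g s with
  | zero =>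
    have hd : Continuous (deriv g) := hg.continuous_deriv (by simp)
    have e : ∫ t in x..(x + s), deriv g t = g (x + s) - g x :=
      intervalIntegral.integral_deriv_eq_sub
        (fun s _ => (hg.differentiable (by simp)).differentiableAt) (hd.intervalIntegrable _ _)
    obtain ⟨h1, h2⟩ := abs_le.1 hs
    simp only [zero_add, range_one, sum_singleton, Function.iterate_zero, id, pow_zero, mul_one,
      Nat.factorial_zero, Nat.cast_one, div_one, one_mul, Function.iterate_one]
    rw [← e]
    refine (intervalIntegral.norm_integral_le_abs_integral_norm
      (f := deriv g) (μ := volume) (a := x) (b := x + s)).trans ?_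
    rw [← abs_of_nonneg (intervalIntegral.integral_nonneg (by linarith)
      (fun t _ => abs_nonneg (deriv g t)) : 0 ≤ ∫ t in (x - r)..(x + r), |deriv g t|)]
    refine intervalIntegral.abs_integral_mono_interval ?_
      (Filter.Eventually.of_forall fun t => abs_nonneg _) (hd.abs.intervalIntegrable _ _)
    rw [Set.uIoc, Set.uIoc]
    refine Set.Ioc_subset_Ioc ?_ ?_
    · rw [min_eq_left (by linarith : x - r ≤ x + r)]
      exact le_min (by linarith) (by linarith)
    · rw [max_eq_right (by linarith : x - r ≤ x + r)]
      exact max_le (by linarith) (by linarith)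
  | succ n ih =>
    have hg' : ContDiff ℝ (⊤ : ℕ∞) (deriv g) := hg.iterate_deriv 1
    have hderiv : ∀ t : ℝ, HasDerivAt
        (fun s => g (x + s) - ∑ k ∈ range (n + 2), deriv^[k] g x * s ^ k / k.factorial)
        (deriv g (x + t) - ∑ k ∈ range (n + 1), deriv^[k] (deriv g) x * t ^ k / k.factorial) t := by
      intro t
      have h1 : HasDerivAt (fun s => g (x + s)) (deriv g (x + t)) t := by
        have := ((hg.differentiable (by simp)).differentiableAt (x := x + t)).hasDerivAt
        exact this.comp_const_add x t
      refine h1.sub ?_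
      simp_rw [sum_range_succ' _ (n + 1)]
      have h2 : HasDerivAt (fun s : ℝ => ∑ k ∈ range (n + 1),
          deriv^[k + 1] g x * s ^ (k + 1) / (k + 1).factorial)
          (∑ k ∈ range (n + 1), deriv^[k] (deriv g) x * t ^ k / k.factorial) t := by
        refine HasDerivAt.fun_sum fun k _ => ?_
        have := ((hasDerivAt_pow (k + 1) t).const_mul (deriv^[k + 1] g x)).div_const
          ((k + 1).factorial : ℝ)
        convert! this using 1
        rw [Nat.factorial_succ, Function.iterate_succ_apply]
        push_cast
        have : (k.factorial : ℝ) ≠ 0 := by positivity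
        field_simp
      simpa using h2.add_const (deriv^[0] g x * 1 / 1)
    have bound : ∀ t ∈ Set.Icc (-r) r,
        ‖deriv g (x + t) - ∑ k ∈ range (n + 1), deriv^[k] (deriv g) x * t ^ k / k.factorial‖
        ≤ r ^ n * ∫ t in (x - r)..(x + r), |deriv^[n + 2] g t| :=
      fun t ht => ih hg' (abs_le.2 ht)
    have := (convex_Icc (-r) r).norm_image_sub_le_of_norm_hasDerivWithin_le
      (fun t _ => (hderiv t).hasDerivWithinAt) bound (x := 0) (y := s)
      ⟨by linarith, hr⟩ (abs_le.1 hs)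
    have h0 : g (x + 0) - ∑ k ∈ range (n + 2), deriv^[k] g x * (0 : ℝ) ^ k / k.factorial = 0 := by
      rw [sum_range_succ']; simp
    rw [h0, sub_zero, sub_zero] at this
    refine this.trans ?_
    have hA : 0 ≤ ∫ t in (x - r)..(x + r), |deriv^[n + 2] g t| :=
      intervalIntegral.integral_nonneg (by linarith) fun t _ => abs_nonneg _
    rw [pow_succ, mul_right_comm]
    exact mul_le_mul_of_nonneg_right (mul_le_mul_of_nonneg_left hs (by positivity)) hA

/-- Truncation error of the fourth order long stencil second derivative in one variable. -/
noncomputable def stencilError (h : ℝ) (g : ℝ → ℝ) (x : ℝ) : ℝ :=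
  (-g (x - 2 * h) + 16 * g (x - h) - 30 * g x + 16 * g (x + h) - g (x + 2 * h)) / (12 * h ^ 2)
    - deriv (deriv g) x

theorem abs_stencilError_le {g : ℝ → ℝ} (hg : ContDiff ℝ (⊤ : ℕ∞) g) (x : ℝ) {h : ℝ} (hh : 0 < h)
    {m : ℕ} (hm : m ≤ 2) :
    |stencilError h g x|
      ≤ 96 * h ^ (m + 1) * ∫ t in (x - 2 * h)..(x + 2 * h), |deriv^[m + 4] g t| := by
  set A := ∫ t in (x - 2 * h)..(x + 2 * h), |deriv^[m + 4] g t| with hA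
  have hA0 : 0 ≤ A := intervalIntegral.integral_nonneg (by linarith) fun t _ => abs_nonneg _
  set R : ℝ → ℝ := fun s =>
    g (x + s) - ∑ k ∈ range (m + 3 + 1), deriv^[k] g x * s ^ k / k.factorial with hR
  have hb : ∀ s, |s| ≤ 2 * h → |R s| ≤ (2 * h) ^ (m + 3) * A :=
    fun s hs => taylor_remainder_le (m + 3) hg x hs
  have e : stencilError h g x
      = (-R (-(2 * h)) + 16 * R (-h) + 16 * R h - R (2 * h)) / (12 * h ^ 2) := by
    have h2 : deriv (deriv g) x = deriv^[2] g x := rfl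
    have h0 : g x = deriv^[0] g x := rfl
    simp only [stencilError, hR]
    rw [h2, h0]
    interval_cases m <;>
    · simp only [sum_range_succ, range_zero, sum_empty, Nat.factorial, zero_add, Nat.reduceAdd,
        Nat.reduceMul, Nat.succ_eq_add_one, Nat.cast_one, Nat.cast_ofNat, ← sub_eq_add_neg]
      field_simp
      ring
  have b1 := abs_le.1 (hb (-(2 * h)) (by rw [abs_neg, abs_of_pos (by linarith)]))
  have b2 := abs_le.1 (hb (-h) (by rw [abs_neg, abs_of_pos hh]; linarith))
  have b3 := abs_le.1 (hb h (by rw [abs_of_pos hh]; linarith))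
  have b4 := abs_le.1 (hb (2 * h) (by rw [abs_of_pos (by linarith)]))
  have b5 : |-R (-(2 * h)) + 16 * R (-h) + 16 * R h - R (2 * h)|
      ≤ 34 * ((2 * h) ^ (m + 3) * A) := by
    rw [abs_le]; constructor <;> linarith
  have h2m : (2 : ℝ) ^ (m + 3) ≤ 32 := by
    calc (2 : ℝ) ^ (m + 3) ≤ 2 ^ 5 := pow_le_pow_right₀ (by norm_num) (by omega)
      _ = 32 := by norm_num
  rw [e, abs_div, abs_of_pos (by positivity : (0 : ℝ) < 12 * h ^ 2), div_le_iff₀ (by positivity)]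
  refine b5.trans ?_
  have : 0 ≤ h ^ (m + 3) * A := by positivity
  calc 34 * ((2 * h) ^ (m + 3) * A) = 34 * 2 ^ (m + 3) * (h ^ (m + 3) * A) := by
        rw [mul_pow]; ring
    _ ≤ 1152 * (h ^ (m + 3) * A) := mul_le_mul_of_nonneg_right (by linarith) this
    _ = 96 * h ^ (m + 1) * A * (12 * h ^ 2) := by ring

theorem periodic_deriv_iterate {g : ℝ → ℝ} {c : ℝ} (hp : Function.Periodic g c) (q : ℕ) :
    Function.Periodic (deriv^[q] g) c := by
  induction q generalizing g with
  | zero => exact hp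
  | succ q ih =>
    refine ih fun x => ?_
    rw [← deriv_comp_add_const]
    exact congrArg (fun w => deriv w x) (funext hp)

theorem sum_sq_stencilError_le {g : ℝ → ℝ} (hg : ContDiff ℝ (⊤ : ℕ∞) g) {h : ℝ} (hh : 0 < h)
    {n : ℕ} (hp : Function.Periodic g (n * h)) {m : ℕ} (hm : m ≤ 2) :
    h * ∑ i ∈ range n, stencilError h g (i * h) ^ 2
      ≤ 147456 * h ^ (2 * m + 4) * ∫ t in (0 : ℝ)..(n * h), deriv^[m + 4] g t ^ 2 := by
  set u := deriv^[m + 4] g with hu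
  have hc : Continuous u := (hg.iterate_deriv (m + 4)).continuous
  have hup : Function.Periodic u (n * h) := periodic_deriv_iterate hp _
  have hc2 : Continuous fun t => u t ^ 2 := by fun_prop
  have shift : ∀ c : ℝ, ∑ i ∈ range n, ∫ t in (i * h + c : ℝ)..(i * h + c + h), u t ^ 2
      = ∫ t in (0 : ℝ)..(n * h), u t ^ 2 := by
    intro c
    have h1 := sum_integral_cells (u := fun t => u (t + c) ^ 2) (by fun_prop) h n
    simp_rw [intervalIntegral.integral_comp_add_right (fun t => u t ^ 2)] at h1
    have h2 : Function.Periodic (fun t => u t ^ 2) (n * h) := fun t => by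
      simp only [hup t]
    have h3 := h2.intervalIntegral_add_eq c 0
    rw [zero_add, add_comm c] at h3
    rw [zero_add] at h1
    rw [← h3, ← h1]
    exact sum_congr rfl fun i _ => by ring_nf
  have cell : ∀ x : ℝ, h * stencilError h g x ^ 2 ≤ 36864 * h ^ (2 * m + 4) *
      ((∫ t in (x + -(2 * h))..(x + -(2 * h) + h), u t ^ 2)
        + (∫ t in (x + -h)..(x + -h + h), u t ^ 2)
        + (∫ t in (x + 0)..(x + 0 + h), u t ^ 2) + ∫ t in (x + h)..(x + h + h), u t ^ 2) := by
    intro x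
    have hi : ∀ a b : ℝ, IntervalIntegrable (fun t => u t ^ 2) volume a b :=
      fun a b => hc2.intervalIntegrable a b
    have e : (∫ t in (x + -(2 * h))..(x + -(2 * h) + h), u t ^ 2)
        + (∫ t in (x + -h)..(x + -h + h), u t ^ 2)
        + (∫ t in (x + 0)..(x + 0 + h), u t ^ 2) + (∫ t in (x + h)..(x + h + h), u t ^ 2)
        = ∫ t in (x - 2 * h)..(x + 2 * h), u t ^ 2 := by
      rw [show x + -(2 * h) + h = x + -h by ring, show x + -h + h = x + 0 by ring,
        show x + 0 + h = x + h by ring, show x + h + h = x + 2 * h by ring,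
        show x + -(2 * h) = x - 2 * h by ring]
      rw [intervalIntegral.integral_add_adjacent_intervals (hi _ _) (hi _ _),
        intervalIntegral.integral_add_adjacent_intervals (hi _ _) (hi _ _),
        intervalIntegral.integral_add_adjacent_intervals (hi _ _) (hi _ _)]
    rw [e]
    have h1 := abs_stencilError_le hg x hh hm
    have h2 := sq_integral_abs_le hc (show x - 2 * h < x + 2 * h by linarith)
    have h3 := pow_le_pow_left₀ (abs_nonneg _) h1 2
    rw [sq_abs, mul_pow] at h3
    calc h * stencilError h g x ^ 2
        ≤ h * ((96 * h ^ (m + 1)) ^ 2 *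
          ((x + 2 * h - (x - 2 * h)) * ∫ t in (x - 2 * h)..(x + 2 * h), u t ^ 2)) := by
          refine mul_le_mul_of_nonneg_left (h3.trans ?_) hh.le
          exact mul_le_mul_of_nonneg_left h2 (by positivity)
      _ = _ := by ring
  rw [mul_sum]
  refine (sum_le_sum fun (i : ℕ) _ => cell (i * h)).trans (le_of_eq ?_)
  rw [← mul_sum, sum_add_distrib, sum_add_distrib, sum_add_distrib, shift, shift, shift, shift]
  ring

/-- Joint smoothness of a curried function of three real variables. -/
def Smooth3D (F : ℝ → ℝ → ℝ → ℝ) : Prop :=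
  ContDiff ℝ (⊤ : ℕ∞) (fun p : ℝ × ℝ × ℝ => F p.1 p.2.1 p.2.2)

noncomputable def partialX (F : ℝ → ℝ → ℝ → ℝ) (x y z : ℝ) : ℝ := deriv (fun s => F s y z) x

noncomputable def partialY (F : ℝ → ℝ → ℝ → ℝ) (x y z : ℝ) : ℝ := deriv (fun s => F x s z) y

noncomputable def partialZ (F : ℝ → ℝ → ℝ → ℝ) (x y z : ℝ) : ℝ := deriv (fun s => F x y s) z

/-- Directional derivative of a curried function of three real variables. -/
noncomputable def dirDeriv3D (v : ℝ × ℝ × ℝ) (F : ℝ → ℝ → ℝ → ℝ) (x y z : ℝ) : ℝ :=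
  fderiv ℝ (fun p : ℝ × ℝ × ℝ => F p.1 p.2.1 p.2.2) (x, y, z) v

namespace Smooth3D

variable {F : ℝ → ℝ → ℝ → ℝ}

theorem comp {E : Type*} [NormedAddCommGroup E] [NormedSpace ℝ E] (hF : Smooth3D F)
    {a b c : E → ℝ} (ha : ContDiff ℝ (⊤ : ℕ∞) a) (hb : ContDiff ℝ (⊤ : ℕ∞) b)
    (hc : ContDiff ℝ (⊤ : ℕ∞) c) : ContDiff ℝ (⊤ : ℕ∞) (fun t => F (a t) (b t) (c t)) :=
  ContDiff.comp (f := fun t => (a t, b t, c t)) hF (ha.prodMk (hb.prodMk hc))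

theorem continuous_comp {E : Type*} [TopologicalSpace E] (hF : Smooth3D F)
    {a b c : E → ℝ} (ha : Continuous a) (hb : Continuous b) (hc : Continuous c) :
    Continuous (fun t => F (a t) (b t) (c t)) :=
  (ContDiff.continuous hF).comp (ha.prodMk (hb.prodMk hc))

theorem sliceX (hF : Smooth3D F) (y z : ℝ) : ContDiff ℝ (⊤ : ℕ∞) (fun s => F s y z) :=
  hF.comp contDiff_id contDiff_const contDiff_const

theorem sliceY (hF : Smooth3D F) (x z : ℝ) : ContDiff ℝ (⊤ : ℕ∞) (fun s => F x s z) :=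
  hF.comp contDiff_const contDiff_id contDiff_const

theorem sliceZ (hF : Smooth3D F) (x y : ℝ) : ContDiff ℝ (⊤ : ℕ∞) (fun s => F x y s) :=
  hF.comp contDiff_const contDiff_const contDiff_id

theorem swapXY (hF : Smooth3D F) : Smooth3D (fun x y z => F y x z) :=
  hF.comp (by fun_prop) (by fun_prop) (by fun_prop)

theorem swapXZ (hF : Smooth3D F) : Smooth3D (fun x y z => F z y x) :=
  hF.comp (by fun_prop) (by fun_prop) (by fun_prop)

theorem dirDeriv3D (hF : Smooth3D F) (v : ℝ × ℝ × ℝ) : Smooth3D (dirDeriv3D v F) :=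
  (ContDiff.fderiv_right hF (by simp) :
    ContDiff ℝ (⊤ : ℕ∞) (fderiv ℝ (fun p : ℝ × ℝ × ℝ => F p.1 p.2.1 p.2.2))).clm_apply
    contDiff_const

theorem dirDeriv3D_comm (hF : Smooth3D F) (v w : ℝ × ℝ × ℝ) :
    _root_.dirDeriv3D v (_root_.dirDeriv3D w F) = _root_.dirDeriv3D w (_root_.dirDeriv3D v F) := by
  have hd : Differentiable ℝ (fderiv ℝ (fun p : ℝ × ℝ × ℝ => F p.1 p.2.1 p.2.2)) :=
    (ContDiff.fderiv_right hF (by simp) : ContDiff ℝ (⊤ : ℕ∞) _).differentiable (by simp)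
  have key : ∀ v w : ℝ × ℝ × ℝ, ∀ p, fderiv ℝ (fun q : ℝ × ℝ × ℝ =>
      fderiv ℝ (fun p : ℝ × ℝ × ℝ => F p.1 p.2.1 p.2.2) q w) p v
      = fderiv ℝ (fderiv ℝ (fun p : ℝ × ℝ × ℝ => F p.1 p.2.1 p.2.2)) p v w := by
    intro v w p
    rw [fderiv_clm_apply (hd p) (differentiableAt_const w)]
    simp
  funext x y z
  have hs : IsSymmSndFDerivAt ℝ (fun p : ℝ × ℝ × ℝ => F p.1 p.2.1 p.2.2) (x, y, z) :=
    (contDiff_infty.1 hF 2).contDiffAt.isSymmSndFDerivAt (by simp)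
  exact (key v w (x, y, z)).trans ((hs v w).trans (key w v (x, y, z)).symm)

theorem partialX_eq (hF : Smooth3D F) : partialX F = _root_.dirDeriv3D (1, 0, 0) F := by
  funext x y z
  have h := ((ContDiff.differentiable hF (by simp)) (x, y, z)).hasFDerivAt.comp_hasDerivAt x
    ((hasDerivAt_id x).prodMk ((hasDerivAt_const x y).prodMk (hasDerivAt_const x z)))
  exact h.deriv

theorem partialY_eq (hF : Smooth3D F) : partialY F = _root_.dirDeriv3D (0, 1, 0) F := by
  funext x y z
  have h := ((ContDiff.differentiable hF (by simp)) (x, y, z)).hasFDerivAt.comp_hasDerivAt y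
    ((hasDerivAt_const y x).prodMk ((hasDerivAt_id y).prodMk (hasDerivAt_const y z)))
  exact h.deriv

theorem partialZ_eq (hF : Smooth3D F) : partialZ F = _root_.dirDeriv3D (0, 0, 1) F := by
  funext x y z
  have h := ((ContDiff.differentiable hF (by simp)) (x, y, z)).hasFDerivAt.comp_hasDerivAt z
    ((hasDerivAt_const z x).prodMk ((hasDerivAt_const z y).prodMk (hasDerivAt_id z)))
  exact h.deriv

theorem partialX (hF : Smooth3D F) : Smooth3D (partialX F) :=
  hF.partialX_eq ▸ hF.dirDeriv3D _

theorem partialY (hF : Smooth3D F) : Smooth3D (partialY F) :=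
  hF.partialY_eq ▸ hF.dirDeriv3D _

theorem partialZ (hF : Smooth3D F) : Smooth3D (partialZ F) :=
  hF.partialZ_eq ▸ hF.dirDeriv3D _

theorem iterate {D : (ℝ → ℝ → ℝ → ℝ) → ℝ → ℝ → ℝ → ℝ}
    (hD : ∀ {G}, Smooth3D G → Smooth3D (D G)) (hF : Smooth3D F) (n : ℕ) :
    Smooth3D (D^[n] F) := by
  induction n with
  | zero => exact hF
  | succ n ih => rw [Function.iterate_succ_apply']; exact hD ih

theorem iterate_comm {D D' : (ℝ → ℝ → ℝ → ℝ) → ℝ → ℝ → ℝ → ℝ}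
    (hD : ∀ {G}, Smooth3D G → Smooth3D (D G))
    (hDD : ∀ {G}, Smooth3D G → D (D' G) = D' (D G)) (hF : Smooth3D F) (n : ℕ) :
    D^[n] (D' F) = D' (D^[n] F) := by
  induction n with
  | zero => rfl
  | succ n ih =>
    rw [Function.iterate_succ_apply', Function.iterate_succ_apply', ih,
      hDD (iterate hD hF n)]

theorem partialY_partialX (hF : Smooth3D F) :
    _root_.partialY (_root_.partialX F) = _root_.partialX (_root_.partialY F) := by
  rw [hF.partialX.partialY_eq, hF.partialX_eq, hF.partialY.partialX_eq, hF.partialY_eq,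
    hF.dirDeriv3D_comm]

theorem partialZ_partialX (hF : Smooth3D F) :
    _root_.partialZ (_root_.partialX F) = _root_.partialX (_root_.partialZ F) := by
  rw [hF.partialX.partialZ_eq, hF.partialX_eq, hF.partialZ.partialX_eq, hF.partialZ_eq,
    hF.dirDeriv3D_comm]

theorem partialZ_partialY (hF : Smooth3D F) :
    _root_.partialZ (_root_.partialY F) = _root_.partialY (_root_.partialZ F) := by
  rw [hF.partialY.partialZ_eq, hF.partialY_eq, hF.partialZ.partialY_eq, hF.partialZ_eq,
    hF.dirDeriv3D_comm]

end Smooth3D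

theorem partialX_iterate (F : ℝ → ℝ → ℝ → ℝ) (n : ℕ) (x y z : ℝ) :
    partialX^[n] F x y z = deriv^[n] (fun s => F s y z) x := by
  induction n generalizing x with
  | zero => rfl
  | succ n ih =>
    rw [Function.iterate_succ_apply', Function.iterate_succ_apply']
    exact congrArg (fun w => deriv w x) (funext fun t => ih t)

theorem partialY_iterate (F : ℝ → ℝ → ℝ → ℝ) (n : ℕ) (x y z : ℝ) :
    partialY^[n] F x y z = deriv^[n] (fun s => F x s z) y := by
  induction n generalizing y with
  | zero => rfl
  | succ n ih =>
    rw [Function.iterate_succ_apply', Function.iterate_succ_apply']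
    exact congrArg (fun w => deriv w y) (funext fun t => ih t)

theorem partialZ_iterate (F : ℝ → ℝ → ℝ → ℝ) (n : ℕ) (x y z : ℝ) :
    partialZ^[n] F x y z = deriv^[n] (fun s => F x y s) z := by
  induction n generalizing z with
  | zero => rfl
  | succ n ih =>
    rw [Function.iterate_succ_apply', Function.iterate_succ_apply']
    exact congrArg (fun w => deriv w z) (funext fun t => ih t)

theorem partialDeriv3D_eq_iterate (a b c : ℕ) (F : ℝ → ℝ → ℝ → ℝ) :
    partialDeriv3D a b c F = partialX^[a] (partialY^[b] (partialZ^[c] F)) := by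
  funext x y z
  simp only [partialDeriv3D, iteratedDeriv_eq_iterate, partialX_iterate, partialY_iterate,
    partialZ_iterate]

theorem Smooth3D.partialDeriv3D {F : ℝ → ℝ → ℝ → ℝ} (hF : Smooth3D F) (a b c : ℕ) :
    Smooth3D (partialDeriv3D a b c F) := by
  rw [partialDeriv3D_eq_iterate]
  exact iterate Smooth3D.partialX (iterate Smooth3D.partialY
    (iterate Smooth3D.partialZ hF c) b) a

theorem integral_sq_partialDeriv3D_le_H6normSq3D {L : ℝ} (hL : 0 ≤ L) (F : ℝ → ℝ → ℝ → ℝ)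
    {a b c : ℕ} (habc : a + b + c ≤ 6) :
    ∫ x in (0 : ℝ)..L, ∫ y in (0 : ℝ)..L, ∫ z in (0 : ℝ)..L, partialDeriv3D a b c F x y z ^ 2
      ≤ H6normSq3D L F := by
  have h0 : ∀ a b c : ℕ, 0 ≤ ∫ x in (0 : ℝ)..L, ∫ y in (0 : ℝ)..L, ∫ z in (0 : ℝ)..L,
      partialDeriv3D a b c F x y z ^ 2 := fun a b c =>
    intervalIntegral.integral_nonneg hL fun x _ => intervalIntegral.integral_nonneg hL fun y _ =>
      intervalIntegral.integral_nonneg hL fun z _ => sq_nonneg _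
  refine le_trans ?_ (single_le_sum (fun a _ => sum_nonneg fun b _ => sum_nonneg fun c _ =>
    h0 a b c) (mem_range.2 (by omega : a < 7)))
  refine le_trans ?_ (single_le_sum (fun b _ => sum_nonneg fun c _ =>
    h0 a b c) (mem_range.2 (by omega : b < 7 - a)))
  exact single_le_sum (f := fun c => ∫ x in (0 : ℝ)..L, ∫ y in (0 : ℝ)..L, ∫ z in (0 : ℝ)..L,
      partialDeriv3D a b c F x y z ^ 2) (fun c _ => h0 a b c)
    (mem_range.2 (by omega : c < 7 - a - b))

theorem integral_swap_of_continuous {u : ℝ → ℝ → ℝ} (hu : Continuous u.uncurry) (a b c d : ℝ) :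
    ∫ x in a..b, ∫ y in c..d, u x y = ∫ y in c..d, ∫ x in a..b, u x y := by
  refine intervalIntegral_intervalIntegral_swap ?_
  refine (hu.continuousOn.integrableOn_compact
    (isCompact_uIcc.prod isCompact_uIcc : IsCompact (Set.uIcc a b ×ˢ Set.uIcc c d))).mono_set ?_
  exact Set.prod_mono Set.uIoc_subset_uIcc Set.uIoc_subset_uIcc

/-- Truncation error of the fourth order long stencil second derivative in the first variable. -/
noncomputable def stencilErrorX (h : ℝ) (F : ℝ → ℝ → ℝ → ℝ) (x y z : ℝ) : ℝ :=
  stencilError h (fun s => F s y z) x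

theorem stencilErrorX_eq (h : ℝ) (F : ℝ → ℝ → ℝ → ℝ) : stencilErrorX h F = fun x y z =>
    (-F (x - 2 * h) y z + 16 * F (x - h) y z - 30 * F x y z + 16 * F (x + h) y z
      - F (x + 2 * h) y z) / (12 * h ^ 2) - partialX (partialX F) x y z := rfl

namespace Smooth3D

variable {F : ℝ → ℝ → ℝ → ℝ}

theorem stencilErrorX (hF : Smooth3D F) (h : ℝ) : Smooth3D (stencilErrorX h F) := by
  have hs : ∀ c : ℝ, ContDiff ℝ (⊤ : ℕ∞) (fun p : ℝ × ℝ × ℝ => F (p.1 + c) p.2.1 p.2.2) :=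
    fun c => hF.comp (by fun_prop) (by fun_prop) (by fun_prop)
  have h0 : ContDiff ℝ (⊤ : ℕ∞) (fun p : ℝ × ℝ × ℝ => F p.1 p.2.1 p.2.2) := hF
  exact ((((((hs (-(2 * h))).neg.add (contDiff_const.mul (hs (-h)))).sub
    (contDiff_const.mul h0)).add (contDiff_const.mul (hs h))).sub
    (hs (2 * h))).div_const _).sub hF.partialX.partialX

theorem partialY_stencilErrorX (hF : Smooth3D F) (h : ℝ) :
    _root_.partialY (_root_.stencilErrorX h F) = _root_.stencilErrorX h (_root_.partialY F) := by
  funext x y z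
  have hs : ∀ c : ℝ, HasDerivAt (fun s => F c s z) (_root_.partialY F c y z) y := fun c =>
    ((hF.sliceY c z).differentiable (by simp) y).hasDerivAt
  have h2 : HasDerivAt (fun s => _root_.partialX (_root_.partialX F) x s z)
      (_root_.partialX (_root_.partialX (_root_.partialY F)) x y z) y := by
    rw [← hF.partialY_partialX, ← hF.partialX.partialY_partialX]
    exact ((hF.partialX.partialX.sliceY x z).differentiable (by simp) y).hasDerivAt
  exact (((((((hs (x - 2 * h)).neg.add ((hs (x - h)).const_mul 16)).sub
    ((hs x).const_mul 30)).add ((hs (x + h)).const_mul 16)).sub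
    (hs (x + 2 * h))).div_const (12 * h ^ 2)).sub h2).deriv

theorem partialZ_stencilErrorX (hF : Smooth3D F) (h : ℝ) :
    _root_.partialZ (_root_.stencilErrorX h F) = _root_.stencilErrorX h (_root_.partialZ F) := by
  funext x y z
  have hs : ∀ c : ℝ, HasDerivAt (fun s => F c y s) (_root_.partialZ F c y z) z := fun c =>
    ((hF.sliceZ c y).differentiable (by simp) z).hasDerivAt
  have h2 : HasDerivAt (fun s => _root_.partialX (_root_.partialX F) x y s)
      (_root_.partialX (_root_.partialX (_root_.partialZ F)) x y z) z := by
    rw [← hF.partialZ_partialX, ← hF.partialX.partialZ_partialX]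
    exact ((hF.partialX.partialX.sliceZ x y).differentiable (by simp) z).hasDerivAt
  exact (((((((hs (x - 2 * h)).neg.add ((hs (x - h)).const_mul 16)).sub
    ((hs x).const_mul 30)).add ((hs (x + h)).const_mul 16)).sub
    (hs (x + 2 * h))).div_const (12 * h ^ 2)).sub h2).deriv

/-- Discrete trace inequality in two variables. -/
theorem sum_sum_sq_grid_le {G : ℝ → ℝ → ℝ → ℝ} (hG : Smooth3D G) {h : ℝ} (hh : 0 < h) (n : ℕ)
    (x : ℝ) :
    h ^ 2 * ∑ j ∈ range n, ∑ k ∈ range n, G x (j * h) (k * h) ^ 2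
      ≤ 4 * (∫ z in (0 : ℝ)..(n * h), ∫ y in (0 : ℝ)..(n * h), G x y z ^ 2)
        + 4 * h ^ 2 * (∫ z in (0 : ℝ)..(n * h), ∫ y in (0 : ℝ)..(n * h),
            _root_.partialY G x y z ^ 2)
        + 4 * h ^ 2 * (∫ z in (0 : ℝ)..(n * h), ∫ y in (0 : ℝ)..(n * h),
            _root_.partialZ G x y z ^ 2)
        + 4 * h ^ 4 * ∫ z in (0 : ℝ)..(n * h), ∫ y in (0 : ℝ)..(n * h),
            _root_.partialY (_root_.partialZ G) x y z ^ 2 := by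
  have hL : (0 : ℝ) ≤ n * h := by positivity
  have stepY : ∀ {H : ℝ → ℝ → ℝ → ℝ}, Smooth3D H →
      h * ∑ j ∈ range n, ∫ z in (0 : ℝ)..(n * h), H x (j * h) z ^ 2
        ≤ 2 * (∫ z in (0 : ℝ)..(n * h), ∫ y in (0 : ℝ)..(n * h), H x y z ^ 2)
        + 2 * h ^ 2 * (∫ z in (0 : ℝ)..(n * h), ∫ y in (0 : ℝ)..(n * h),
            _root_.partialY H x y z ^ 2) := by
    intro H hH
    have cH : Continuous (fun p : ℝ × ℝ => H x p.2 p.1 ^ 2) :=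
      (hH.continuous_comp (by fun_prop) (by fun_prop) (by fun_prop)).pow 2
    have cH' : Continuous (fun p : ℝ × ℝ => _root_.partialY H x p.2 p.1 ^ 2) :=
      (hH.partialY.continuous_comp (by fun_prop) (by fun_prop) (by fun_prop)).pow 2
    have cj : ∀ y : ℝ, Continuous (fun z => H x y z ^ 2) := fun y =>
      (hH.sliceZ x y).continuous.pow 2
    have c1 : Continuous (fun z => ∫ y in (0 : ℝ)..(n * h), H x y z ^ 2) :=
      intervalIntegral.continuous_parametric_intervalIntegral_of_continuous' cH _ _
    have c2 : Continuous (fun z => ∫ y in (0 : ℝ)..(n * h), _root_.partialY H x y z ^ 2) :=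
      intervalIntegral.continuous_parametric_intervalIntegral_of_continuous' cH' _ _
    rw [← intervalIntegral.integral_finsetSum fun j _ => (cj _).intervalIntegrable _ _,
      ← intervalIntegral.integral_const_mul, ← intervalIntegral.integral_const_mul,
      ← intervalIntegral.integral_const_mul, ← intervalIntegral.integral_add
        ((c1.const_mul _).intervalIntegrable _ _) ((c2.const_mul _).intervalIntegrable _ _)]
    refine intervalIntegral.integral_mono_on hL
      ((continuous_const.mul (continuous_finsetSum _ fun j _ => cj _)).intervalIntegrable _ _)
      (((c1.const_mul _).add (c2.const_mul _)).intervalIntegrable _ _) fun z _ => ?_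
    exact sum_sq_grid_le ((hH.sliceY x z).of_le (by simp)) hh n
  have stepZ : ∀ j : ℕ, h * ∑ k ∈ range n, G x (j * h) (k * h) ^ 2
      ≤ 2 * (∫ z in (0 : ℝ)..(n * h), G x (j * h) z ^ 2)
        + 2 * h ^ 2 * ∫ z in (0 : ℝ)..(n * h), _root_.partialZ G x (j * h) z ^ 2 := fun j =>
    sum_sq_grid_le ((hG.sliceZ x (j * h)).of_le (by simp)) hh n
  have h1 := stepY hG
  have h2 := mul_le_mul_of_nonneg_left (stepY hG.partialZ) (sq_nonneg h)
  have h3 : h * ∑ j ∈ range n, (h * ∑ k ∈ range n, G x (j * h) (k * h) ^ 2)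
      ≤ h * ∑ j ∈ range n, (2 * (∫ z in (0 : ℝ)..(n * h), G x (j * h) z ^ 2)
        + 2 * h ^ 2 * ∫ z in (0 : ℝ)..(n * h), _root_.partialZ G x (j * h) z ^ 2) :=
    mul_le_mul_of_nonneg_left (sum_le_sum fun j _ => stepZ j) hh.le
  rw [← mul_sum, sum_add_distrib, ← mul_sum, ← mul_sum] at h3
  linear_combination h3 + 2 * h1 + 2 * h2

theorem sum_integral_sq_stencilErrorX_le (hF : Smooth3D F) {h : ℝ} (hh : 0 < h) {n : ℕ}
    (hp : ∀ x y z, F (x + n * h) y z = F x y z) {m : ℕ} (hm : m ≤ 2) :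
    h * ∑ i ∈ range n, ∫ z in (0 : ℝ)..(n * h), ∫ y in (0 : ℝ)..(n * h),
        _root_.stencilErrorX h F (i * h) y z ^ 2
      ≤ 147456 * h ^ (2 * m + 4) * ∫ z in (0 : ℝ)..(n * h), ∫ y in (0 : ℝ)..(n * h),
        ∫ x in (0 : ℝ)..(n * h), _root_.partialX^[m + 4] F x y z ^ 2 := by
  have hL : (0 : ℝ) ≤ n * h := by positivity
  have hT := hF.stencilErrorX h
  have hD : Smooth3D (_root_.partialX^[m + 4] F) := iterate Smooth3D.partialX hF _
  have cT : ∀ x : ℝ, Continuous (fun p : ℝ × ℝ => _root_.stencilErrorX h F x p.2 p.1 ^ 2) :=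
    fun x => (hT.continuous_comp (by fun_prop) (by fun_prop) (by fun_prop)).pow 2
  have cTy : ∀ x z : ℝ, Continuous (fun y => _root_.stencilErrorX h F x y z ^ 2) :=
    fun x z => (hT.sliceY x z).continuous.pow 2
  have cT' : ∀ x : ℝ, Continuous (fun z => ∫ y in (0 : ℝ)..(n * h),
      _root_.stencilErrorX h F x y z ^ 2) := fun x =>
    intervalIntegral.continuous_parametric_intervalIntegral_of_continuous' (cT x) _ _
  have cD : Continuous (fun p : ℝ × ℝ =>
      ∫ x in (0 : ℝ)..(n * h), _root_.partialX^[m + 4] F x p.2 p.1 ^ 2) :=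
    intervalIntegral.continuous_parametric_intervalIntegral_of_continuous'
      (f := fun p : ℝ × ℝ => fun x => _root_.partialX^[m + 4] F x p.2 p.1 ^ 2)
      ((hD.continuous_comp (by fun_prop) (by fun_prop) (by fun_prop)).pow 2) _ _
  have cD' : Continuous (fun z => ∫ y in (0 : ℝ)..(n * h),
      ∫ x in (0 : ℝ)..(n * h), _root_.partialX^[m + 4] F x y z ^ 2) :=
    intervalIntegral.continuous_parametric_intervalIntegral_of_continuous' cD _ _
  rw [← intervalIntegral.integral_finsetSum fun i _ => (cT' _).intervalIntegrable _ _,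
    ← intervalIntegral.integral_const_mul, ← intervalIntegral.integral_const_mul]
  refine intervalIntegral.integral_mono_on hL
    ((continuous_const.mul (continuous_finsetSum _ fun i _ => cT' _)).intervalIntegrable _ _)
    ((continuous_const.mul cD').intervalIntegrable _ _) fun z _ => ?_
  have cDy : Continuous (fun y => ∫ x in (0 : ℝ)..(n * h),
      _root_.partialX^[m + 4] F x y z ^ 2) := cD.comp (Continuous.prodMk_right z)
  rw [← intervalIntegral.integral_finsetSum fun i _ => (cTy _ _).intervalIntegrable _ _,
    ← intervalIntegral.integral_const_mul, ← intervalIntegral.integral_const_mul]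
  refine intervalIntegral.integral_mono_on hL
    ((continuous_const.mul (continuous_finsetSum _ fun i _ => cTy _ z)).intervalIntegrable _ _)
    ((continuous_const.mul cDy).intervalIntegrable _ _) fun y _ => ?_
  simp only [partialX_iterate]
  exact sum_sq_stencilError_le (hF.sliceX y z) hh (fun x => hp x y z) hm

/-- Grid `ℓ²` bound for the truncation error in the first variable. -/
theorem sum_sq_stencilErrorX_le (hF : Smooth3D F) {h : ℝ} (hh : 0 < h) {n : ℕ}
    (hp : ∀ x y z, F (x + n * h) y z = F x y z) {B : ℝ}
    (h1 : ∫ z in (0 : ℝ)..(n * h), ∫ y in (0 : ℝ)..(n * h), ∫ x in (0 : ℝ)..(n * h),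
      _root_.partialX^[6] F x y z ^ 2 ≤ B)
    (h2 : ∫ z in (0 : ℝ)..(n * h), ∫ y in (0 : ℝ)..(n * h), ∫ x in (0 : ℝ)..(n * h),
      _root_.partialX^[5] (_root_.partialY F) x y z ^ 2 ≤ B)
    (h3 : ∫ z in (0 : ℝ)..(n * h), ∫ y in (0 : ℝ)..(n * h), ∫ x in (0 : ℝ)..(n * h),
      _root_.partialX^[5] (_root_.partialZ F) x y z ^ 2 ≤ B)
    (h4 : ∫ z in (0 : ℝ)..(n * h), ∫ y in (0 : ℝ)..(n * h), ∫ x in (0 : ℝ)..(n * h),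
      _root_.partialX^[4] (_root_.partialY (_root_.partialZ F)) x y z ^ 2 ≤ B) :
    h ^ 3 * ∑ i ∈ range n, ∑ j ∈ range n, ∑ k ∈ range n,
        _root_.stencilErrorX h F (i * h) (j * h) (k * h) ^ 2
      ≤ 2359296 * h ^ 8 * B := by
  have hpY : ∀ {G : ℝ → ℝ → ℝ → ℝ}, (∀ x y z, G (x + n * h) y z = G x y z) →
      ∀ x y z, _root_.partialY G (x + n * h) y z = _root_.partialY G x y z := fun hG x y z =>
    congrArg (fun w => deriv w y) (funext fun s => hG x s z)
  have hpZ : ∀ {G : ℝ → ℝ → ℝ → ℝ}, (∀ x y z, G (x + n * h) y z = G x y z) →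
      ∀ x y z, _root_.partialZ G (x + n * h) y z = _root_.partialZ G x y z := fun hG x y z =>
    congrArg (fun w => deriv w z) (funext fun s => hG x y s)
  have b1 := (hF.sum_integral_sq_stencilErrorX_le hh hp (m := 2) le_rfl).trans
    (mul_le_mul_of_nonneg_left h1 (by positivity))
  have b2 := (hF.partialY.sum_integral_sq_stencilErrorX_le hh (hpY hp) (m := 1) (by norm_num)).trans
    (mul_le_mul_of_nonneg_left h2 (by positivity))
  have b3 := (hF.partialZ.sum_integral_sq_stencilErrorX_le hh (hpZ hp) (m := 1) (by norm_num)).trans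
    (mul_le_mul_of_nonneg_left h3 (by positivity))
  have b4 := (hF.partialZ.partialY.sum_integral_sq_stencilErrorX_le hh (hpY (hpZ hp)) (m := 0)
    (by norm_num)).trans (mul_le_mul_of_nonneg_left h4 (by positivity))
  have hsum := mul_le_mul_of_nonneg_left (sum_le_sum fun (i : ℕ) (_ : i ∈ range n) =>
    (hF.stencilErrorX h).sum_sum_sq_grid_le hh n (i * h)) hh.le
  rw [hF.partialZ_stencilErrorX, hF.partialZ.partialY_stencilErrorX,
    hF.partialY_stencilErrorX] at hsum
  simp only [sum_add_distrib, ← mul_sum] at hsum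
  have b2' := mul_le_mul_of_nonneg_left b2 (sq_nonneg h)
  have b3' := mul_le_mul_of_nonneg_left b3 (sq_nonneg h)
  have b4' := mul_le_mul_of_nonneg_left b4 (by positivity : 0 ≤ h ^ 4)
  simp only [Nat.reduceMul, Nat.reduceAdd] at b1 b2' b3' b4'
  linear_combination hsum + 4 * b1 + 4 * b2' + 4 * b3' + 4 * b4'

end Smooth3D

section BoxIntegral

variable {G : ℝ → ℝ → ℝ → ℝ} (L : ℝ)

theorem integral_box_swap_inner (hG : Smooth3D G) :
    ∫ x in (0 : ℝ)..L, ∫ y in (0 : ℝ)..L, ∫ z in (0 : ℝ)..L, G x y z ^ 2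
      = ∫ x in (0 : ℝ)..L, ∫ z in (0 : ℝ)..L, ∫ y in (0 : ℝ)..L, G x y z ^ 2 := by
  congr 1
  funext x
  have hc : Continuous (fun p : ℝ × ℝ => G x p.1 p.2 ^ 2) :=
    (hG.continuous_comp (by fun_prop) (by fun_prop) (by fun_prop)).pow 2
  exact integral_swap_of_continuous (u := fun y z => G x y z ^ 2) hc _ _ _ _

theorem integral_box_swap_outer (hG : Smooth3D G) :
    ∫ x in (0 : ℝ)..L, ∫ y in (0 : ℝ)..L, ∫ z in (0 : ℝ)..L, G x y z ^ 2
      = ∫ y in (0 : ℝ)..L, ∫ x in (0 : ℝ)..L, ∫ z in (0 : ℝ)..L, G x y z ^ 2 :=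
  integral_swap_of_continuous (u := fun x y => ∫ z in (0 : ℝ)..L, G x y z ^ 2)
    (intervalIntegral.continuous_parametric_intervalIntegral_of_continuous'
      (f := fun p : ℝ × ℝ => fun z => G p.1 p.2 z ^ 2)
      ((hG.continuous_comp (by fun_prop) (by fun_prop) (by fun_prop)).pow 2) _ _) _ _ _ _

theorem integral_box_rotate (hG : Smooth3D G) :
    ∫ z in (0 : ℝ)..L, ∫ x in (0 : ℝ)..L, ∫ y in (0 : ℝ)..L, G x y z ^ 2
      = ∫ x in (0 : ℝ)..L, ∫ y in (0 : ℝ)..L, ∫ z in (0 : ℝ)..L, G x y z ^ 2 := by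
  have hP : Smooth3D (fun z x y => G x y z) :=
    hG.comp (by fun_prop) (by fun_prop) (by fun_prop)
  rw [integral_box_swap_outer L hP, integral_box_swap_inner L hG]

theorem integral_box_reverse (hG : Smooth3D G) :
    ∫ z in (0 : ℝ)..L, ∫ y in (0 : ℝ)..L, ∫ x in (0 : ℝ)..L, G x y z ^ 2
      = ∫ x in (0 : ℝ)..L, ∫ y in (0 : ℝ)..L, ∫ z in (0 : ℝ)..L, G x y z ^ 2 := by
  rw [integral_box_swap_inner L hG.swapXZ, integral_box_rotate L hG]

end BoxIntegral

/-- The truncation error is the sum of the three one-directional errors. -/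
theorem discLap4_3D_sub_contLap3D (h : ℝ) (f : ℝ → ℝ → ℝ → ℝ) (x y z : ℝ) :
    discLap4_3D h f x y z - contLap3D f x y z
      = stencilErrorX h f x y z + stencilErrorX h (fun x y z => f y x z) y x z
        + stencilErrorX h (fun x y z => f z y x) z y x := by
  simp only [discLap4_3D, contLap3D, stencilErrorX, stencilError]
  ring

section GridBounds

variable {F : ℝ → ℝ → ℝ → ℝ} {h : ℝ} {n : ℕ}

theorem sum_sq_stencilErrorX_le_H6 (hF : Smooth3D F) (hh : 0 < h)
    (hp : ∀ x y z, F (x + n * h) y z = F x y z) :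
    h ^ 3 * ∑ i ∈ range n, ∑ j ∈ range n, ∑ k ∈ range n,
        stencilErrorX h F (i * h) (j * h) (k * h) ^ 2
      ≤ 2359296 * h ^ 8 * H6normSq3D (n * h) F := by
  have hL : (0 : ℝ) ≤ n * h := by positivity
  have key : ∀ a b c : ℕ, a + b + c ≤ 6 →
      ∫ z in (0 : ℝ)..(n * h), ∫ y in (0 : ℝ)..(n * h), ∫ x in (0 : ℝ)..(n * h),
        partialX^[a] (partialY^[b] (partialZ^[c] F)) x y z ^ 2 ≤ H6normSq3D (n * h) F := by
    intro a b c habc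
    rw [← partialDeriv3D_eq_iterate, integral_box_reverse _ (hF.partialDeriv3D a b c)]
    exact integral_sq_partialDeriv3D_le_H6normSq3D hL F habc
  exact hF.sum_sq_stencilErrorX_le hh hp (key 6 0 0 (by norm_num)) (key 5 1 0 (by norm_num))
    (key 5 0 1 (by norm_num)) (key 4 1 1 (by norm_num))

theorem sum_sq_stencilErrorX_swapXY_le_H6 (hF : Smooth3D F) (hh : 0 < h)
    (hp : ∀ x y z, F x (y + n * h) z = F x y z) :
    h ^ 3 * ∑ i ∈ range n, ∑ j ∈ range n, ∑ k ∈ range n,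
        stencilErrorX h (fun x y z => F y x z) (j * h) (i * h) (k * h) ^ 2
      ≤ 2359296 * h ^ 8 * H6normSq3D (n * h) F := by
  have hL : (0 : ℝ) ≤ n * h := by positivity
  have hswap : ∀ (G : ℝ → ℝ → ℝ → ℝ) (m : ℕ) (x y z : ℝ),
      partialX^[m] (fun x y z => G y x z) x y z = partialY^[m] G y x z := fun G m x y z => by
    rw [partialX_iterate, partialY_iterate]
  have key : ∀ a b c : ℕ, a + b + c ≤ 6 → ∀ G : ℝ → ℝ → ℝ → ℝ,
      partialY^[b] G = partialX^[a] (partialY^[b] (partialZ^[c] F)) →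
      ∫ z in (0 : ℝ)..(n * h), ∫ y in (0 : ℝ)..(n * h), ∫ x in (0 : ℝ)..(n * h),
        partialX^[b] (fun x y z => G y x z) x y z ^ 2 ≤ H6normSq3D (n * h) F := by
    intro a b c habc G hG
    simp only [hswap]
    rw [hG, ← partialDeriv3D_eq_iterate, integral_box_rotate _ (hF.partialDeriv3D a b c)]
    exact integral_sq_partialDeriv3D_le_H6normSq3D hL F habc
  rw [sum_comm]
  exact hF.swapXY.sum_sq_stencilErrorX_le hh (fun x y z => hp y x z)
    (key 0 6 0 (by norm_num) F rfl)
    (key 1 5 0 (by norm_num) (partialX F)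
      (hF.iterate_comm Smooth3D.partialY Smooth3D.partialY_partialX 5))
    (key 0 5 1 (by norm_num) (partialZ F) rfl)
    (key 1 4 1 (by norm_num) (partialX (partialZ F))
      (hF.partialZ.iterate_comm Smooth3D.partialY Smooth3D.partialY_partialX 4))

theorem sum_sq_stencilErrorX_swapXZ_le_H6 (hF : Smooth3D F) (hh : 0 < h)
    (hp : ∀ x y z, F x y (z + n * h) = F x y z) :
    h ^ 3 * ∑ i ∈ range n, ∑ j ∈ range n, ∑ k ∈ range n,
        stencilErrorX h (fun x y z => F z y x) (k * h) (j * h) (i * h) ^ 2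
      ≤ 2359296 * h ^ 8 * H6normSq3D (n * h) F := by
  have hL : (0 : ℝ) ≤ n * h := by positivity
  have hswap : ∀ (G : ℝ → ℝ → ℝ → ℝ) (m : ℕ) (x y z : ℝ),
      partialX^[m] (fun x y z => G z y x) x y z = partialZ^[m] G z y x := fun G m x y z => by
    rw [partialX_iterate, partialZ_iterate]
  have key : ∀ a b c : ℕ, a + b + c ≤ 6 → ∀ G : ℝ → ℝ → ℝ → ℝ,
      partialZ^[c] G = partialX^[a] (partialY^[b] (partialZ^[c] F)) →
      ∫ z in (0 : ℝ)..(n * h), ∫ y in (0 : ℝ)..(n * h), ∫ x in (0 : ℝ)..(n * h),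
        partialX^[c] (fun x y z => G z y x) x y z ^ 2 ≤ H6normSq3D (n * h) F := by
    intro a b c habc G hG
    simp only [hswap]
    rw [hG, ← partialDeriv3D_eq_iterate]
    exact integral_sq_partialDeriv3D_le_H6normSq3D hL F habc
  have hperm : ∀ g : ℕ → ℕ → ℕ → ℝ, ∑ i ∈ range n, ∑ j ∈ range n, ∑ k ∈ range n, g k j i
      = ∑ k ∈ range n, ∑ j ∈ range n, ∑ i ∈ range n, g k j i := by
    intro g
    rw [sum_congr rfl fun i _ => sum_comm, sum_comm]
    exact sum_congr rfl fun k _ => sum_comm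
  rw [hperm fun k j i => stencilErrorX h (fun x y z => F z y x) (k * h) (j * h) (i * h) ^ 2]
  exact hF.swapXZ.sum_sq_stencilErrorX_le hh (fun x y z => hp z y x)
    (key 0 0 6 (by norm_num) F rfl)
    (key 0 1 5 (by norm_num) (partialY F)
      (hF.iterate_comm Smooth3D.partialZ Smooth3D.partialZ_partialY 5))
    (key 1 0 5 (by norm_num) (partialX F)
      (hF.iterate_comm Smooth3D.partialZ Smooth3D.partialZ_partialX 5))
    (key 1 1 4 (by norm_num) (partialY (partialX F)) (by
      rw [hF.partialY_partialX, hF.partialY.iterate_comm Smooth3D.partialZ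
        Smooth3D.partialZ_partialX 4, hF.iterate_comm Smooth3D.partialZ
        Smooth3D.partialZ_partialY 4]
      rfl))

end GridBounds

/-- Discrete ℓ² truncation error estimate for the 3-D long stencil fourth order
discrete Laplacian, for smooth periodic test functions. -/
theorem long_stencil_laplacian_truncation_l2_3D (L : ℝ) (hL : 0 < L) :
    ∃ C : ℝ, 0 < C ∧
      ∀ N : ℕ, 0 < N →
        ∀ h : ℝ, h = L / (2 * N + 1) →
          ∀ f : ℝ → ℝ → ℝ → ℝ, ContDiff ℝ (⊤ : ℕ∞) (fun p : ℝ × ℝ × ℝ => f p.1 p.2.1 p.2.2) →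
            (∀ x y z, f (x + L) y z = f x y z) → (∀ x y z, f x (y + L) z = f x y z) →
            (∀ x y z, f x y (z + L) = f x y z) →
            Real.sqrt (h ^ 3 *
                ∑ i ∈ Finset.range (2 * N + 1), ∑ j ∈ Finset.range (2 * N + 1),
                  ∑ k ∈ Finset.range (2 * N + 1),
                    (discLap4_3D h f ((i : ℝ) * h) ((j : ℝ) * h) ((k : ℝ) * h)
                      - contLap3D f ((i : ℝ) * h) ((j : ℝ) * h) ((k : ℝ) * h)) ^ 2)
              ≤ C * h ^ 4 * Real.sqrt (H6normSq3D L f) := by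
  refine ⟨4608, by norm_num, fun N _ h hh f hf hx hy hz => ?_⟩
  have hN : (0 : ℝ) < 2 * N + 1 := by positivity
  have hpos : 0 < h := hh ▸ div_pos hL hN
  have hnL : ((2 * N + 1 : ℕ) : ℝ) * h = L := by
    rw [hh]; push_cast; field_simp
  set n := 2 * N + 1 with hn
  have hF : Smooth3D f := hf
  have hX := sum_sq_stencilErrorX_le_H6 (n := n) hF hpos (by rwa [hnL])
  have hY := sum_sq_stencilErrorX_swapXY_le_H6 (n := n) hF hpos (by rwa [hnL])
  have hZ := sum_sq_stencilErrorX_swapXZ_le_H6 (n := n) hF hpos (by rwa [hnL])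
  rw [hnL] at hX hY hZ
  have hsum : ∑ i ∈ range n, ∑ j ∈ range n, ∑ k ∈ range n,
      (discLap4_3D h f ((i : ℝ) * h) ((j : ℝ) * h) ((k : ℝ) * h)
        - contLap3D f ((i : ℝ) * h) ((j : ℝ) * h) ((k : ℝ) * h)) ^ 2
      ≤ ∑ i ∈ range n, ∑ j ∈ range n, ∑ k ∈ range n,
        (3 * stencilErrorX h f (i * h) (j * h) (k * h) ^ 2
          + 3 * stencilErrorX h (fun x y z => f y x z) (j * h) (i * h) (k * h) ^ 2
          + 3 * stencilErrorX h (fun x y z => f z y x) (k * h) (j * h) (i * h) ^ 2) := by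
    refine sum_le_sum fun i _ => sum_le_sum fun j _ => sum_le_sum fun k _ => ?_
    rw [discLap4_3D_sub_contLap3D]
    generalize stencilErrorX h f (i * h) (j * h) (k * h) = a
    generalize stencilErrorX h (fun x y z => f y x z) (j * h) (i * h) (k * h) = b
    generalize stencilErrorX h (fun x y z => f z y x) (k * h) (j * h) (i * h) = c
    nlinarith [sq_nonneg (a - b), sq_nonneg (b - c), sq_nonneg (a - c)]
  simp only [sum_add_distrib, ← mul_sum] at hsum
  have htotal := mul_le_mul_of_nonneg_left hsum (by positivity : 0 ≤ h ^ 3)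
  calc _ ≤ Real.sqrt ((4608 * h ^ 4) ^ 2 * H6normSq3D L f) := by
        refine Real.sqrt_le_sqrt ?_
        linear_combination htotal + 3 * hX + 3 * hY + 3 * hZ
    _ = 4608 * h ^ 4 * Real.sqrt (H6normSq3D L f) := by
        rw [Real.sqrt_mul (sq_nonneg _), Real.sqrt_sq (by positivity)]
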